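/- arXiv:2212.01530 — 2 statements merged into one kernel-verified Lean document; each statement's English description precedes it below -/
import Mathlib

section
/- Let J = χ_{B_r} and let Ω ⊆ ℝⁿ be a bounded measurable set with diameter strictly less than r/2. Then for every x₁ ∈ ∂Ω, H^J_Ω(x₁) = |B_r| − 2|Ω|; in particular H^J_Ω is constant on ∂Ω, so the constant nonlocal mean curvature condition with kernel χ_{B_r} does not determine Ω uniquely among sets of diameter less than r/2. -/
open MeasureTheory Set Metric

/-- The nonlocal mean curvature of a set `Ω` at a point `x`, with kernel `J`:
`H^J_Ω(x) = ∫ J(x-y) (χ_{Ωᶜ}(y) - χ_Ω(y)) dy`. -/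
noncomputable def nlCurv {d : ℕ} (J : EuclideanSpace ℝ (Fin d) → ℝ)
    (Ω : Set (EuclideanSpace ℝ (Fin d))) (x : EuclideanSpace ℝ (Fin d)) : ℝ :=
  ∫ y, J (x - y) *
    (Set.indicator Ωᶜ (fun _ => (1 : ℝ)) y - Set.indicator Ω (fun _ => (1 : ℝ)) y)

/-- for the constant kernel `J = χ_{B_r}` and a bounded measurable set `Ω`
of diameter strictly less than `r/2`, the nonlocal mean curvature equals
`|B_r| - 2 |Ω|` at every boundary point `x₁ ∈ ∂Ω`; in particular it is constant on `∂Ω`,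
so the constant curvature condition does not determine `Ω` uniquely among such sets. -/
theorem nlCurv_const_kernel_small_diam {d : ℕ} (r : ℝ) (hr : 0 < r)
    (Ω : Set (EuclideanSpace ℝ (Fin d))) (hΩmeas : MeasurableSet Ω)
    (hΩbdd : Bornology.IsBounded Ω) (hdiam : Metric.diam Ω < r / 2) :
    ∀ x₁ ∈ frontier Ω,
      nlCurv (Set.indicator (Metric.ball (0 : EuclideanSpace ℝ (Fin d)) r)
          (fun _ => (1 : ℝ))) Ω x₁
        = (volume (Metric.ball (0 : EuclideanSpace ℝ (Fin d)) r)).toReal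
          - 2 * (volume Ω).toReal := by
  intro x₁ hx₁
  have hsub : Ω ⊆ ball x₁ r := fun y hy => by
    have h := dist_le_diam_of_mem hΩbdd.closure (subset_closure hy) (frontier_subset_closure hx₁)
    rw [diam_closure] at h
    rw [mem_ball]
    linarith
  have hint : ∀ y, indicator (ball (0 : EuclideanSpace ℝ (Fin d)) r) (fun _ => (1 : ℝ)) (x₁ - y) *
      (indicator Ωᶜ (fun _ => (1 : ℝ)) y - indicator Ω (fun _ => (1 : ℝ)) y) =
      indicator (ball x₁ r) (fun _ => (1 : ℝ)) y - 2 * indicator Ω (fun _ => (1 : ℝ)) y := by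
    intro y
    have hball : x₁ - y ∈ ball (0 : EuclideanSpace ℝ (Fin d)) r ↔ y ∈ ball x₁ r := by
      rw [mem_ball_zero_iff, mem_ball', dist_eq_norm]
    by_cases hy : y ∈ Ω
    · have hyb := hsub hy
      simp only [indicator, hball, hyb, hy, mem_compl_iff, not_true_eq_false, if_true, if_false]
      norm_num
    · simp [indicator, hball, hy]
  have hball_int : Integrable (indicator (ball x₁ r) (fun _ => (1 : ℝ))) :=
    (integrable_indicator_iff measurableSet_ball).2 (integrableOn_const measure_ball_lt_top.ne)
  have hΩ_int : Integrable (indicator Ω (fun _ => (1 : ℝ))) :=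
    (integrable_indicator_iff hΩmeas).2 (integrableOn_const hΩbdd.measure_lt_top.ne)
  unfold nlCurv
  simp_rw [hint]
  rw [integral_sub hball_int (hΩ_int.const_mul 2), integral_const_mul,
    integral_indicator_const _ measurableSet_ball, integral_indicator_const _ hΩmeas,
    smul_eq_mul, smul_eq_mul, mul_one, mul_one, measureReal_def, measureReal_def,
    Measure.addHaar_ball_center]
end

section
/- Let f : ℝ^{n-1} → ℝ be a C¹ function with |∇f(y')| ≤ M < 1, fix a unit vector ν ∈ ℝ^{n-1}, and define G(ρ) = √(ρ² + f(ρν)²) for ρ > 0. Then G'(ρ) ≥ (1−M²)ρ/G(ρ) > 0, so G is strictly increasing; moreover, since ρ ≥ G(ρ)/√(1+M²), the inverse function ρ = Gn(λ; ν) satisfies dρ/dλ ≤ √(1+M²)/(1−M²), i.e., the inverse is Lipschitz with constant √(1+M²)/(1−M²) independent of ν. -/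
open MeasureTheory Set Metric

noncomputable section

theorem HasDerivAt.sqrt_sq_add_sq {g : ℝ → ℝ} {g' t : ℝ} (hg : HasDerivAt g g' t) (ht : 0 < t) :
    HasDerivAt (fun s => √(s ^ 2 + g s ^ 2)) ((t + g t * g') / √(t ^ 2 + g t ^ 2)) t := by
  have h : HasDerivAt (fun s => s ^ 2 + g s ^ 2) (2 * t + 2 * g t * g') t := by
    simpa using (hasDerivAt_pow 2 t).fun_add (hg.fun_pow 2)
  convert h.sqrt (by positivity) using 1
  have : 0 < √(t ^ 2 + g t ^ 2) := by positivity
  field_simp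

theorem abs_comp_smul_le_of_norm_fderiv_le {E : Type*} [NormedAddCommGroup E] [NormedSpace ℝ E]
    {f : E → ℝ} {M : ℝ} (hf : Differentiable ℝ f) (hf0 : f 0 = 0)
    (hgrad : ∀ y, ‖fderiv ℝ f y‖ ≤ M) {ν : E} (hν : ‖ν‖ = 1) {t : ℝ} (ht : 0 ≤ t) :
    |f (t • ν)| ≤ M * t := by
  have h := convex_univ.norm_image_sub_le_of_norm_fderiv_le (𝕜 := ℝ) (f := f)
    (fun x _ => hf x) (fun x _ => hgrad x) (mem_univ 0) (mem_univ (t • ν))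
  simpa [hf0, norm_smul, hν, abs_of_nonneg ht] using h

theorem sqrt_sq_add_sq_le_sqrt_one_add_sq_mul {M t a : ℝ} (ht : 0 ≤ t) (ha : |a| ≤ M * t) :
    √(t ^ 2 + a ^ 2) ≤ √(1 + M ^ 2) * t := by
  rw [Real.sqrt_le_left (by positivity), mul_pow, Real.sq_sqrt (by positivity)]
  have := sq_le_sq.2 (ha.trans (le_abs_self _))
  linarith

/-- let `f : ℝⁿ → ℝ` be `C¹` with `f 0 = 0` and `|∇f| ≤ M < 1`, fix a
unit vector `ν`, and set `G(ρ) = √(ρ² + f(ρν)²)`. Then for every `ρ > 0`, `G` is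
differentiable at `ρ` with `G'(ρ) ≥ (1-M²)ρ/G(ρ) > 0`, hence `G` is strictly
increasing on `(0,∞)`; moreover `ρ ≥ G(ρ)/√(1+M²)`, and the inverse of `G` is
Lipschitz with constant `√(1+M²)/(1-M²)` independent of `ν`:
`ρ₂ - ρ₁ ≤ (√(1+M²)/(1-M²)) (G(ρ₂) - G(ρ₁))`. -/
theorem graph_distance_strictly_increasing {n : ℕ} (M : ℝ)
    (hM0 : 0 ≤ M) (hM : M < 1)
    (f : EuclideanSpace ℝ (Fin n) → ℝ)
    (hf : ContDiff ℝ 1 f) (hf0 : f 0 = 0)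
    (hgrad : ∀ y' : EuclideanSpace ℝ (Fin n), ‖fderiv ℝ f y'‖ ≤ M)
    (ν : EuclideanSpace ℝ (Fin n)) (hν : ‖ν‖ = 1) :
    (∀ ρ : ℝ, 0 < ρ →
      DifferentiableAt ℝ (fun t : ℝ => Real.sqrt (t ^ 2 + (f (t • ν)) ^ 2)) ρ ∧
      0 < (1 - M ^ 2) * ρ / Real.sqrt (ρ ^ 2 + (f (ρ • ν)) ^ 2) ∧
      (1 - M ^ 2) * ρ / Real.sqrt (ρ ^ 2 + (f (ρ • ν)) ^ 2)
        ≤ deriv (fun t : ℝ => Real.sqrt (t ^ 2 + (f (t • ν)) ^ 2)) ρ) ∧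
    StrictMonoOn (fun t : ℝ => Real.sqrt (t ^ 2 + (f (t • ν)) ^ 2)) (Set.Ioi 0) ∧
    (∀ ρ : ℝ, 0 ≤ ρ →
      Real.sqrt (ρ ^ 2 + (f (ρ • ν)) ^ 2) / Real.sqrt (1 + M ^ 2) ≤ ρ) ∧
    (∀ ρ₁ ρ₂ : ℝ, 0 < ρ₁ → ρ₁ ≤ ρ₂ →
      ρ₂ - ρ₁ ≤ (Real.sqrt (1 + M ^ 2) / (1 - M ^ 2)) *
        (Real.sqrt (ρ₂ ^ 2 + (f (ρ₂ • ν)) ^ 2)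
          - Real.sqrt (ρ₁ ^ 2 + (f (ρ₁ • ν)) ^ 2))) := by
  have hdf : Differentiable ℝ f := hf.differentiable (by norm_num)
  have hM2 : 0 < 1 - M ^ 2 := by nlinarith
  have hS : 0 < √(1 + M ^ 2) := by positivity
  have hbound : ∀ t : ℝ, 0 ≤ t → |f (t • ν)| ≤ M * t := fun t ht =>
    abs_comp_smul_le_of_norm_fderiv_le hdf hf0 hgrad hν ht
  have hray : ∀ t : ℝ, HasDerivAt (fun s : ℝ => f (s • ν)) (fderiv ℝ f (t • ν) ν) t := fun t => by
    have h : HasDerivAt (fun s : ℝ => s • ν) ν t := by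
      simpa using (hasDerivAt_id t).smul_const ν
    exact (hdf (t • ν)).hasFDerivAt.comp_hasDerivAt t h
  have hslope : ∀ t : ℝ, |fderiv ℝ f (t • ν) ν| ≤ M := fun t => by
    simpa [hν] using (fderiv ℝ f (t • ν)).le_of_opNorm_le (hgrad _) ν
  have hder := fun (t : ℝ) (ht : 0 < t) => (hray t).sqrt_sq_add_sq ht
  have hlower : ∀ t : ℝ, 0 < t → (1 - M ^ 2) * t / √(t ^ 2 + f (t • ν) ^ 2)
      ≤ deriv (fun s : ℝ => √(s ^ 2 + f (s • ν) ^ 2)) t := fun t ht => by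
    rw [(hder t ht).deriv]
    gcongr
    have h := mul_le_mul (hbound t ht.le) (hslope t) (abs_nonneg _) (by positivity)
    rw [← abs_mul] at h
    linarith [neg_le_of_abs_le h]
  have hpos : ∀ t : ℝ, 0 < t → 0 < (1 - M ^ 2) * t / √(t ^ 2 + f (t • ν) ^ 2) :=
    fun t ht => by positivity
  have hcont : ContinuousOn (fun s : ℝ => √(s ^ 2 + f (s • ν) ^ 2)) (Ioi 0) :=
    fun t ht => (hder t ht).continuousAt.continuousWithinAt
  refine ⟨fun t ht => ⟨(hder t ht).differentiableAt, hpos t ht, hlower t ht⟩,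
    strictMonoOn_of_deriv_pos (convex_Ioi 0) hcont fun t ht => ?_, fun t ht => ?_,
    fun a b ha hab => ?_⟩
  · rw [interior_Ioi] at ht
    exact (hpos t ht).trans_le (hlower t ht)
  · rw [div_le_iff₀' hS]
    exact sqrt_sq_add_sq_le_sqrt_one_add_sq_mul ht (hbound t ht)
  · have h := (convex_Ioi (0 : ℝ)).mul_sub_le_image_sub_of_le_deriv
      (C := (1 - M ^ 2) / √(1 + M ^ 2)) hcont
      (fun t ht => by
        rw [interior_Ioi] at ht
        exact (hder t ht).differentiableAt.differentiableWithinAt)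
      (fun t ht => by
        rw [interior_Ioi] at ht
        have ht' : 0 < t := ht
        refine le_trans ?_ (hlower t ht)
        rw [div_le_div_iff₀ hS (by positivity), mul_assoc, mul_comm t]
        exact mul_le_mul_of_nonneg_left
          (sqrt_sq_add_sq_le_sqrt_one_add_sq_mul ht'.le (hbound t ht'.le)) hM2.le)
      a ha b (ha.trans_le hab) hab
    calc b - a = √(1 + M ^ 2) / (1 - M ^ 2) * ((1 - M ^ 2) / √(1 + M ^ 2) * (b - a)) := by
          field_simp
      _ ≤ _ := mul_le_mul_of_nonneg_left h (by positivity)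

end
end
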